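/- arXiv:2409.03355 — 6 statements merged into one kernel-verified Lean document; each statement's English description precedes it below -/
import Mathlib

section
/- For every natural number k, every positive integer υ, all real p, q with q > −1 and p + q not an integer ≥ 1, and all real y, z, the finite bivariate M-Konhauser polynomial can be expanded in terms of the Konhauser polynomials Z: _K M_{k;υ}^{(p,q)}(y,z) = (−1)^k k! Γ(k+q+1) Σ_{l=0}^{k} (−1)^l (k+1−p)_l (−y)^l Z_{k−l}^{(−p−q)}(z;υ) / (l! Γ(l+q+1) Γ(υ(k−l)−p−q+1)). -/
open Finset

/-- Pochhammer symbol `(a)_n = a (a+1) ⋯ (a+n-1)` for real `a`. -/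
noncomputable def poch (a : ℝ) (n : ℕ) : ℝ := (ascPochhammer ℝ n).eval a

/-- The finite bivariate M-Konhauser polynomial `_K M_{k;υ}^{(p,q)}(y,z)`. -/
noncomputable def MK (p q : ℝ) (υ k : ℕ) (y z : ℝ) : ℝ :=
  (-1 : ℝ) ^ k * Real.Gamma ((k : ℝ) + q + 1) *
    ∑ l ∈ range (k + 1), ∑ s ∈ range (k - l + 1),
      poch (-(k : ℝ)) (l + s) * poch ((k : ℝ) + 1 - p) l * (-y) ^ l * z ^ (υ * s) /
        (Real.Gamma ((l : ℝ) + q + 1) * Real.Gamma ((υ : ℝ) * (s : ℝ) - p - q + 1) *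
          (l.factorial : ℝ) * (s.factorial : ℝ))

/-- The Konhauser polynomial `Z_n^{(c)}(z;υ)`. -/
noncomputable def ZK (c : ℝ) (υ n : ℕ) (z : ℝ) : ℝ :=
  Real.Gamma ((υ : ℝ) * (n : ℝ) + c + 1) / (n.factorial : ℝ) *
    ∑ j ∈ range (n + 1),
      (-1 : ℝ) ^ j * (n.choose j : ℝ) * z ^ (υ * j) / Real.Gamma ((υ : ℝ) * (j : ℝ) + c + 1)

/-- `(-(n + m))_n = (-1)^n (n + m)! / m!`. -/
theorem poch_neg_add_mul_factorial (n m : ℕ) :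
    poch (-((n + m : ℕ) : ℝ)) n * (m.factorial : ℝ) = (-1 : ℝ) ^ n * ((n + m).factorial : ℝ) := by
  induction n generalizing m with
  | zero => simp [poch]
  | succ n ih =>
    have h := ih (m + 1)
    rw [show n + (m + 1) = n + 1 + m by ring, Nat.factorial_succ m] at h
    simp only [poch] at h ⊢
    rw [ascPochhammer_succ_eval]
    push_cast at h ⊢
    rw [pow_succ]
    linear_combination -h

/-- Expansion of the finite bivariate M-Konhauser polynomial in terms of the
Konhauser polynomials `Z_{k-l}^{(-p-q)}(z;υ)`. -/
theorem MK_eq_sum_ZK (k υ : ℕ) (hυ : 0 < υ) (p q : ℝ) (hq : q > -1)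
    (hpq : ∀ n : ℕ, 1 ≤ n → p + q ≠ (n : ℝ)) (y z : ℝ) :
    MK p q υ k y z =
      (-1 : ℝ) ^ k * (k.factorial : ℝ) * Real.Gamma ((k : ℝ) + q + 1) *
        ∑ l ∈ range (k + 1),
          (-1 : ℝ) ^ l * poch ((k : ℝ) + 1 - p) l * (-y) ^ l * ZK (-p - q) υ (k - l) z /
            ((l.factorial : ℝ) * Real.Gamma ((l : ℝ) + q + 1) *
              Real.Gamma ((υ : ℝ) * ((k - l : ℕ) : ℝ) - p - q + 1)) := by
  have hΓ (m : ℕ) : Real.Gamma ((υ : ℝ) * (m : ℝ) - p - q + 1) ≠ 0 := by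
    refine Real.Gamma_ne_zero fun n hn => hpq (υ * m + n + 1) (by omega) ?_
    push_cast
    linarith
  rw [MK, mul_right_comm _ (k.factorial : ℝ), mul_assoc _ (k.factorial : ℝ),
    Finset.mul_sum _ _ (k.factorial : ℝ)]
  congr 1
  refine Finset.sum_congr rfl fun l hl => ?_
  rw [ZK, Finset.mul_sum, Finset.mul_sum, Finset.sum_div, Finset.mul_sum]
  refine Finset.sum_congr rfl fun s hs => ?_
  obtain ⟨m, rfl⟩ : ∃ m, k = l + s + m :=
    Nat.exists_eq_add_of_le (by simp only [Finset.mem_range] at hl hs; omega)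
  have hsub : l + s + m - l = s + m := by omega
  rw [hsub]
  have hP := poch_neg_add_mul_factorial (l + s) m
  have hC : ((s + m).choose s : ℝ) = ((s + m).factorial : ℝ) / (s.factorial * m.factorial) :=
    Nat.cast_add_choose ℝ
  have hm : (m.factorial : ℝ) ≠ 0 := by positivity
  have hG (j : ℕ) : (υ : ℝ) * j + (-p - q) + 1 = υ * j - p - q + 1 := by ring
  have hl0 : Real.Gamma ((l : ℝ) + q + 1) ≠ 0 :=
    (Real.Gamma_pos_of_pos (by have := l.cast_nonneg (α := ℝ); linarith)).ne'
  have hs0 := hΓ s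
  have hsm := hΓ (s + m)
  rw [hC, eq_div_of_mul_eq hm hP, hG, hG, pow_add]
  field_simp
end

section
/- For every natural number k, every positive integer υ, all real p, q with q > −1 and p + q not an integer ≥ 1, and all real y, z, the finite bivariate M-Konhauser polynomial has the (Kampé de Fériet type) double hypergeometric series representation _K M_{k;υ}^{(p,q)}(y,z) = [(−1)^k (q+1)_k / Γ(1−p−q)] · Σ_{l=0}^{k} Σ_{s=0}^{k−l} [(−k)_{l+s} (k+1−p)_l / ((q+1)_l · Π_{j=0}^{υ−1} ((1−p−q+j)/υ)_s)] · (−y)^l ((z/υ)^υ)^s / (l! s!). -/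
open Finset

theorem poch_eq_prod_range (a : ℝ) (n : ℕ) : poch a n = ∏ i ∈ range n, (a + i) := by
  induction n with
  | zero => simp [poch]
  | succ n ih => rw [prod_range_succ, ← ih, poch, poch, ascPochhammer_succ_eval]

theorem Gamma_nat_add_eq_poch_mul {a : ℝ} (ha : ∀ m : ℕ, a ≠ -m) (n : ℕ) :
    Real.Gamma (n + a) = poch a n * Real.Gamma a := by
  induction n with
  | zero => simp [poch]
  | succ n ih =>
    have hn : (n : ℝ) + a ≠ 0 := fun h => ha n (by linarith)
    rw [Nat.cast_succ, add_right_comm, Real.Gamma_add_one hn, ih, poch_eq_prod_range,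
      poch_eq_prod_range, prod_range_succ]
    ring

/-- The Gauss multiplication formula for Pochhammer symbols. -/
theorem poch_mul_eq_pow_mul_prod {n : ℕ} (hn : 0 < n) (a : ℝ) (s : ℕ) :
    poch a (n * s) = (n : ℝ) ^ (n * s) * ∏ j ∈ range n, poch ((a + j) / n) s := by
  have hn' : (n : ℝ) ≠ 0 := by positivity
  induction s with
  | zero => simp [poch]
  | succ s ih =>
    have hblock : ∏ j ∈ range n, (a + ((n * s + j : ℕ) : ℝ)) =
        (n : ℝ) ^ n * ∏ j ∈ range n, ((a + j) / n + s) := by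
      rw [← card_range n, ← prod_const, card_range, ← prod_mul_distrib]
      refine prod_congr rfl fun j _ => ?_
      push_cast
      field_simp
      ring
    have hsucc (b : ℝ) : poch b (s + 1) = poch b s * (b + s) := by
      simp only [poch_eq_prod_range, prod_range_succ]
    rw [Nat.mul_succ, poch_eq_prod_range, prod_range_add, ← poch_eq_prod_range, ih, hblock]
    simp only [hsucc, prod_mul_distrib]
    ring

/-- Kampé de Fériet type double hypergeometric series representation of the finite
bivariate M-Konhauser polynomial. -/
theorem MK_eq_KampeDeFeriet (k υ : ℕ) (hυ : 0 < υ) (p q : ℝ) (hq : q > -1)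
    (hpq : ∀ n : ℕ, 1 ≤ n → p + q ≠ (n : ℝ)) (y z : ℝ) :
    MK p q υ k y z =
      (-1 : ℝ) ^ k * poch (q + 1) k / Real.Gamma (1 - p - q) *
        ∑ l ∈ range (k + 1), ∑ s ∈ range (k - l + 1),
          poch (-(k : ℝ)) (l + s) * poch ((k : ℝ) + 1 - p) l /
              (poch (q + 1) l * ∏ j ∈ range υ, poch ((1 - p - q + (j : ℝ)) / (υ : ℝ)) s) *
            (-y) ^ l * ((z / (υ : ℝ)) ^ υ) ^ s / ((l.factorial : ℝ) * (s.factorial : ℝ)) := by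
  have hq' (m : ℕ) : q + 1 ≠ -(m : ℝ) := by
    have : (0 : ℝ) ≤ m := m.cast_nonneg
    intro h
    linarith
  have hpq' (m : ℕ) : 1 - p - q ≠ -(m : ℝ) := fun h =>
    hpq (m + 1) (by omega) (by push_cast; linarith)
  have hΓ : Real.Gamma (q + 1) ≠ 0 := Real.Gamma_ne_zero hq'
  rw [MK, mul_sum, mul_sum]
  refine sum_congr rfl fun l _ => ?_
  rw [mul_sum, mul_sum]
  refine sum_congr rfl fun s _ => ?_
  have hs : (υ : ℝ) * s - p - q + 1 = ((υ * s : ℕ) : ℝ) + (1 - p - q) := by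
    push_cast
    ring
  rw [hs, add_assoc (k : ℝ), add_assoc (l : ℝ), Gamma_nat_add_eq_poch_mul hq',
    Gamma_nat_add_eq_poch_mul hq', Gamma_nat_add_eq_poch_mul hpq', poch_mul_eq_pow_mul_prod hυ,
    ← pow_mul, div_pow]
  field_simp
end

section
/- For every natural number k, every positive integer υ, all real p, q with q > −1 and p + q not an integer ≥ 1, and all real y, z, the finite bivariate M-Konhauser polynomial equals (−1)^k Γ(k+q+1) times the bivariate Jacobi Konhauser Mittag-Leffler function with parameters γ₁ = −k, γ₂ = k+1−p evaluated at (−y, z): _K M_{k;υ}^{(p,q)}(y,z) = (−1)^k Γ(k+q+1) · Σ_{l=0}^{∞} Σ_{m=0}^{∞} (−k)_{m+l} (k+1−p)_l (−y)^l z^{υm} / (Γ(q+1+l) Γ(1−p−q+υm) l! m!), where the double series converges (it terminates, since (−k)_{m+l} = 0 for m + l > k). -/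
open Finset

/-- General term of the bivariate Jacobi Konhauser Mittag-Leffler function
`E_{q+1,1-p-q,υ}^{(-k;k+1-p)}(-y,z)`. -/
noncomputable def MLterm (p q : ℝ) (υ k : ℕ) (y z : ℝ) (l m : ℕ) : ℝ :=
  poch (-(k : ℝ)) (m + l) * poch ((k : ℝ) + 1 - p) l * (-y) ^ l * z ^ (υ * m) /
    (Real.Gamma (q + 1 + (l : ℝ)) * Real.Gamma (1 - p - q + (υ : ℝ) * (m : ℝ)) *
      (l.factorial : ℝ) * (m.factorial : ℝ))

/-- The Pochhammer symbol `(-k)_n` vanishes for `n > k`. -/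
theorem poch_neg_natCast_of_lt {k n : ℕ} (h : k < n) : poch (-(k : ℝ)) n = 0 :=
  ascPochhammer_eval_neg_coe_nat_of_lt h

theorem MLterm_eq_zero_of_lt (p q : ℝ) (υ : ℕ) {k l m : ℕ} (y z : ℝ) (h : k < m + l) :
    MLterm p q υ k y z l m = 0 := by
  simp [MLterm, poch_neg_natCast_of_lt h]

theorem tsum_tsum_MLterm (p q : ℝ) (υ k : ℕ) (y z : ℝ) :
    ∑' (l : ℕ) (m : ℕ), MLterm p q υ k y z l m =
      ∑ l ∈ range (k + 1), ∑ m ∈ range (k - l + 1), MLterm p q υ k y z l m := by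
  rw [tsum_eq_sum (s := range (k + 1))]
  · refine sum_congr rfl fun l _ => tsum_eq_sum fun m hm => MLterm_eq_zero_of_lt _ _ _ _ _ ?_
    rw [mem_range] at hm
    omega
  · intro l hl
    rw [mem_range] at hl
    simp [fun m => MLterm_eq_zero_of_lt p q υ y z (show k < m + l by omega)]

/-- The finite bivariate M-Konhauser polynomial equals `(-1)^k Γ(k+q+1)` times the bivariate
Jacobi Konhauser Mittag-Leffler function `E_{q+1,1-p-q,υ}^{(-k;k+1-p)}(-y,z)`, the double
series being convergent (indeed terminating). -/
theorem MK_eq_MittagLeffler (k υ : ℕ) (hυ : 0 < υ) (p q : ℝ) (hq : q > -1)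
    (hpq : ∀ n : ℕ, 1 ≤ n → p + q ≠ (n : ℝ)) (y z : ℝ) :
    Summable (fun lm : ℕ × ℕ => MLterm p q υ k y z lm.1 lm.2) ∧
    MK p q υ k y z =
      (-1 : ℝ) ^ k * Real.Gamma ((k : ℝ) + q + 1) *
        ∑' (l : ℕ) (m : ℕ), MLterm p q υ k y z l m := by
  constructor
  · refine summable_of_ne_finset_zero (s := range (k + 1) ×ˢ range (k + 1)) fun lm h =>
      MLterm_eq_zero_of_lt _ _ _ _ _ ?_
    simp only [mem_product, mem_range] at h
    omega
  · rw [tsum_tsum_MLterm, MK]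
    congr 1
    refine sum_congr rfl fun l _ => sum_congr rfl fun m _ => ?_
    rw [MLterm, add_comm l m, show (l : ℝ) + q + 1 = q + 1 + l by ring,
      show (υ : ℝ) * m - p - q + 1 = 1 - p - q + υ * m by ring]
end

section
/- For every natural number k, every positive integer υ, all real p, q with q > −1, and all real y, z, the second sets of the biorthogonal pairs are related by 𝒦ℳ_{k;υ}^{(p,q)}(y,z) = (−1)^k k! · Q_{k;υ}^{(q,−p−q)}(2y+1, z). -/
open Finset

/-- The finite univariate orthogonal polynomial `M_k^{(p,q)}(y)`. -/
noncomputable def Mpoly (p q : ℝ) (k : ℕ) (y : ℝ) : ℝ :=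
  (-1 : ℝ) ^ k * Real.Gamma ((k : ℝ) + q + 1) *
    ∑ m ∈ range (k + 1),
      poch (-(k : ℝ)) m * poch ((k : ℝ) + 1 - p) m * (-y) ^ m /
        ((m.factorial : ℝ) * Real.Gamma ((m : ℝ) + q + 1))

/-- The Konhauser polynomial `Y_j^{(c)}(z;υ)`. -/
noncomputable def YK (c : ℝ) (υ j : ℕ) (z : ℝ) : ℝ :=
  (1 / (j.factorial : ℝ)) *
    ∑ i ∈ range (j + 1), z ^ i / (i.factorial : ℝ) *
      ∑ n ∈ range (i + 1),
        (-1 : ℝ) ^ n * (i.choose n : ℝ) * poch ((1 + c + (n : ℝ)) / (υ : ℝ)) j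

/-- The second set `𝒦ℳ_{k;υ}^{(p,q)}(y,z) = M_k^{(p,q)}(y) Σ_{j=0}^k Y_j^{(-p-q)}(z;υ)`. -/
noncomputable def MM (p q : ℝ) (υ k : ℕ) (y z : ℝ) : ℝ :=
  Mpoly p q k y * ∑ j ∈ range (k + 1), YK (-p - q) υ j z

/-- The classical Jacobi polynomial `P_k^{(p,q)}(y)`. -/
noncomputable def JacobiP (p q : ℝ) (k : ℕ) (y : ℝ) : ℝ :=
  poch (p + 1) k / (k.factorial : ℝ) *
    ∑ m ∈ range (k + 1),
      poch (-(k : ℝ)) m * poch ((k : ℝ) + p + q + 1) m /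
        (poch (p + 1) m * (m.factorial : ℝ)) * ((1 - y) / 2) ^ m

/-- The second set of the bivariate Jacobi Konhauser pair,
`Q_{k;υ}^{(p,q)}(y,z) = P_k^{(p,q)}(y) Σ_{j=0}^k Y_j^{(q)}(z;υ)`. -/
noncomputable def QJK (p q : ℝ) (υ k : ℕ) (y z : ℝ) : ℝ :=
  JacobiP p q k y * ∑ j ∈ range (k + 1), YK q υ j z

theorem poch_pos {a : ℝ} (ha : 0 < a) (n : ℕ) : 0 < poch a n :=
  ascPochhammer_pos n a ha

theorem Gamma_natCast_add_eq_poch_mul {a : ℝ} (ha : 0 < a) (n : ℕ) :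
    Real.Gamma (n + a) = poch a n * Real.Gamma a := by
  induction n with
  | zero => simp [poch]
  | succ n ih =>
    have hne : (n : ℝ) + a ≠ 0 := by positivity
    have hstep : ((n + 1 : ℕ) : ℝ) + a = (n + a) + 1 := by push_cast; ring
    rw [hstep, Real.Gamma_add_one hne, ih, poch, poch, ascPochhammer_succ_eval]
    ring

theorem Mpoly_eq_JacobiP {q : ℝ} (hq : -1 < q) (p : ℝ) (k : ℕ) (y : ℝ) :
    Mpoly p q k y =
      (-1 : ℝ) ^ k * (k.factorial : ℝ) * JacobiP q (-p - q) k (2 * y + 1) := by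
  have ha : 0 < q + 1 := by linarith
  have hGamma : Real.Gamma (q + 1) ≠ 0 := (Real.Gamma_pos_of_pos ha).ne'
  have hfac : (k.factorial : ℝ) ≠ 0 := mod_cast k.factorial_ne_zero
  have hparam : (k : ℝ) + q + (-p - q) + 1 = k + 1 - p := by ring
  have hvar : (1 - (2 * y + 1)) / 2 = -y := by ring
  simp only [Mpoly, JacobiP, hparam, hvar, add_assoc _ q 1,
    Gamma_natCast_add_eq_poch_mul ha, mul_sum]
  refine sum_congr rfl fun m _ => ?_
  have hpoch := (poch_pos ha m).ne'
  have hm : (m.factorial : ℝ) ≠ 0 := mod_cast m.factorial_ne_zero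
  field_simp

/-- Relation between the second sets of the two biorthogonal pairs:
`𝒦ℳ_{k;υ}^{(p,q)}(y,z) = (-1)^k k! Q_{k;υ}^{(q,-p-q)}(2y+1,z)`. -/
theorem MM_eq_QJK (k υ : ℕ) (hυ : 0 < υ) (p q : ℝ) (hq : q > -1) (y z : ℝ) :
    MM p q υ k y z = (-1 : ℝ) ^ k * (k.factorial : ℝ) * QJK q (-p - q) υ k (2 * y + 1) z := by
  rw [MM, QJK, Mpoly_eq_JacobiP hq, mul_assoc]
end

section
/- Let υ be a positive integer, k ∈ ℕ, and let p, q be reals with q > −1 and p + q < 1. Let a > 0 and w be reals with w^υ ≠ a^υ, and let y be real. Then ∫_0^∞ e^{−a z} z^{−p−q} · _K M_{k;υ}^{(p,q)}(y, w z) dz = a^{p+q−1} · ((a^υ − w^υ)/a^υ)^k · M_k^{(p,q)}( y a^υ/(a^υ − w^υ) ). -/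
open Finset MeasureTheory

/-- Splitting a Pochhammer symbol with nonpositive integer parameter. -/
lemma poch_neg_natCast_add (k l s : ℕ) :
    poch (-(k : ℝ)) (l + s) =
      poch (-(k : ℝ)) l * ((-1) ^ s * (s.factorial : ℝ) * ((k - l).choose s : ℝ)) := by
  have h : ∀ n, poch (-(k : ℝ)) n = (-1) ^ n * (k.descFactorial n : ℝ) := fun n => by
    rw [poch, ascPochhammer_eval_neg_eq_descPochhammer, descPochhammer_eval_eq_descFactorial]
  have h' : k.descFactorial (l + s) = (k - l).descFactorial s * k.descFactorial l := by
    rw [← Nat.descFactorial_mul_descFactorial (Nat.le_add_right l s), Nat.add_sub_cancel_left]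
  rw [h, h, h', Nat.descFactorial_eq_factorial_mul_choose (k - l) s]
  push_cast
  ring

/-- Terminating binomial theorem with Pochhammer coefficients. -/
lemma sum_poch_neg_natCast_add (k l : ℕ) (x : ℝ) :
    ∑ s ∈ range (k - l + 1), poch (-(k : ℝ)) (l + s) * x ^ s / (s.factorial : ℝ) =
      poch (-(k : ℝ)) l * (1 - x) ^ (k - l) := by
  rw [sub_eq_neg_add, add_pow, mul_sum]
  refine sum_congr rfl fun s _ => ?_
  rw [poch_neg_natCast_add, neg_pow x]
  field_simp
  simp

/-- Laplace transform of `z ^ b * z ^ n` for a real exponent `b > -1`. -/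
lemma integral_exp_neg_mul_rpow_mul_pow {a b : ℝ} (ha : 0 < a) (hb : -1 < b) (n : ℕ) :
    ∫ z in Set.Ioi (0 : ℝ), Real.exp (-(a * z)) * z ^ b * z ^ n =
      (1 / a) ^ (n + b + 1) * Real.Gamma (n + b + 1) := by
  have hpos : 0 < n + b + 1 := by linarith [n.cast_nonneg (α := ℝ)]
  rw [← Real.integral_rpow_mul_exp_neg_mul_Ioi hpos ha]
  refine setIntegral_congr_fun measurableSet_Ioi fun z hz => ?_
  have hz : 0 < z := hz
  rw [mul_assoc, ← Real.rpow_add_natCast hz.ne', mul_comm]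
  ring_nf

lemma integrableOn_exp_neg_mul_rpow_mul_pow {a b : ℝ} (ha : 0 < a) (hb : -1 < b) (n : ℕ) :
    IntegrableOn (fun z : ℝ => Real.exp (-(a * z)) * z ^ b * z ^ n) (Set.Ioi 0) := by
  refine Integrable.of_integral_ne_zero ?_
  rw [integral_exp_neg_mul_rpow_mul_pow ha hb]
  have hpos : 0 < n + b + 1 := by linarith [n.cast_nonneg (α := ℝ)]
  have := Real.Gamma_pos_of_pos hpos
  positivity

/-- Laplace transform of the finite bivariate M-Konhauser polynomials in the second
variable, expressed through the finite polynomials `M_k^{(p,q)}`. -/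
theorem MK_laplace_Mpoly (υ : ℕ) (hυ : 0 < υ) (k : ℕ) (p q : ℝ) (hq : q > -1)
    (hpq : p + q < 1) (a w : ℝ) (ha : 0 < a) (hw : w ^ υ ≠ a ^ υ) (y : ℝ) :
    (∫ z in Set.Ioi (0 : ℝ), Real.exp (-(a * z)) * z ^ (-p - q) * MK p q υ k y (w * z))
      = a ^ (p + q - 1) * ((a ^ υ - w ^ υ) / a ^ υ) ^ k *
        Mpoly p q k (y * a ^ υ / (a ^ υ - w ^ υ)) := by
  have hb : -1 < -p - q := by linarith
  have hGamma (s : ℕ) : 0 < Real.Gamma ((υ : ℝ) * s - p - q + 1) :=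
    Real.Gamma_pos_of_pos (by nlinarith [mul_nonneg υ.cast_nonneg (α := ℝ) s.cast_nonneg])
  have hsub : a ^ υ - w ^ υ ≠ 0 := sub_ne_zero.mpr hw.symm
  set c : ℕ → ℕ → ℝ := fun l s =>
    poch (-(k : ℝ)) (l + s) * poch ((k : ℝ) + 1 - p) l * (-y) ^ l * w ^ (υ * s) /
      (Real.Gamma ((l : ℝ) + q + 1) * Real.Gamma ((υ : ℝ) * (s : ℝ) - p - q + 1) *
        (l.factorial : ℝ) * (s.factorial : ℝ)) with hc
  set C : ℝ := (-1 : ℝ) ^ k * Real.Gamma ((k : ℝ) + q + 1) with hC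
  have hintegrable (l s : ℕ) : IntegrableOn (fun z : ℝ =>
      c l s * (Real.exp (-(a * z)) * z ^ (-p - q) * z ^ (υ * s))) (Set.Ioi 0) :=
    (integrableOn_exp_neg_mul_rpow_mul_pow ha hb _).const_mul _
  have hexpand (z : ℝ) : Real.exp (-(a * z)) * z ^ (-p - q) * MK p q υ k y (w * z) =
      C * ∑ l ∈ range (k + 1), ∑ s ∈ range (k - l + 1),
        c l s * (Real.exp (-(a * z)) * z ^ (-p - q) * z ^ (υ * s)) := by
    rw [MK, ← hC, mul_left_comm]
    simp only [mul_sum, hc, mul_pow]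
    refine sum_congr rfl fun l _ => sum_congr rfl fun s _ => ?_
    ring
  simp only [hexpand]
  rw [integral_const_mul,
    integral_finsetSum _ fun l _ => integrable_finsetSum _ fun s _ => hintegrable l s,
    Mpoly, ← hC, mul_left_comm]
  congr 1
  rw [mul_sum]
  refine sum_congr rfl fun l hl => ?_
  have hl : l ≤ k := Nat.lt_succ_iff.mp (mem_range.mp hl)
  rw [integral_finsetSum _ fun s _ => hintegrable l s]
  have hterm (s : ℕ) :
      ∫ z in Set.Ioi (0 : ℝ), c l s * (Real.exp (-(a * z)) * z ^ (-p - q) * z ^ (υ * s)) =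
        a ^ (p + q - 1) * (poch ((k : ℝ) + 1 - p) l * (-y) ^ l /
          ((l.factorial : ℝ) * Real.Gamma ((l : ℝ) + q + 1))) *
        (poch (-(k : ℝ)) (l + s) * ((w / a) ^ υ) ^ s / (s.factorial : ℝ)) := by
    have hpow : (1 / a) ^ (((υ * s : ℕ) : ℝ) + (-p - q) + 1) =
        a ^ (p + q - 1) / a ^ (υ * s) := by
      rw [one_div, Real.inv_rpow ha.le, ← Real.rpow_neg ha.le, ← Real.rpow_sub_natCast ha.ne']
      ring_nf
    have hG : ((υ * s : ℕ) : ℝ) + (-p - q) + 1 = (υ : ℝ) * s - p - q + 1 := by push_cast; ring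
    rw [integral_const_mul, integral_exp_neg_mul_rpow_mul_pow ha hb, hpow, hG, ← pow_mul, div_pow]
    have := (hGamma s).ne'
    simp only [hc]
    field_simp
  have hfactor : ((a ^ υ - w ^ υ) / a ^ υ) ^ k * (-(y * a ^ υ / (a ^ υ - w ^ υ))) ^ l =
      (-y) ^ l * (1 - (w / a) ^ υ) ^ (k - l) := by
    have hx : 1 - (w / a) ^ υ = (a ^ υ - w ^ υ) / a ^ υ := by
      rw [div_pow]; field_simp
    rw [hx]
    obtain ⟨m, rfl⟩ := Nat.exists_eq_add_of_le hl
    rw [Nat.add_sub_cancel_left, pow_add, mul_right_comm, ← mul_pow]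
    congr 2
    field_simp
  simp only [hterm]
  rw [← mul_sum, sum_poch_neg_natCast_add]
  linear_combination (-(a ^ (p + q - 1) * (poch (-(k : ℝ)) l * poch ((k : ℝ) + 1 - p) l /
    ((l.factorial : ℝ) * Real.Gamma ((l : ℝ) + q + 1))))) * hfactor
end

section
/- Let υ be a positive integer, k ∈ ℕ, and let p, q be reals with q > −1 and p + q < 1. Let a > 0, b > 0, and w₁, w₂ be reals with w₂^υ ≠ b^υ. Then ∫_0^∞ ∫_0^∞ e^{−(a y + b z)} y^q z^{−p−q} · _K M_{k;υ}^{(p,q)}(w₁ y, w₂ z) dy dz = [Γ(k+q+1) / (a^{q+1} b^{1−p−q})] · ((w₂^υ − b^υ)/b^υ)^k · Y_k( w₁ b^υ/(a (b^υ − w₂^υ)); 2−p, 1 ), where Y_k(x; α, β) is the generalized Bessel polynomial. -/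
open Finset MeasureTheory

/-- The generalized Bessel polynomial
`Y_k(x; α, β) = ₂F₀[-k, k+α-1; -; -x/β]`. -/
noncomputable def BesselY (k : ℕ) (x α β : ℝ) : ℝ :=
  ∑ l ∈ range (k + 1),
    poch (-(k : ℝ)) l * poch ((k : ℝ) + α - 1) l / (l.factorial : ℝ) * (-x / β) ^ l

theorem poch_add (x : ℝ) (m n : ℕ) : poch x (m + n) = poch x m * poch (x + m) n := by
  simp [poch, ← ascPochhammer_mul, Polynomial.eval_comp]

theorem poch_neg_nat (n s : ℕ) :
    poch (-(n : ℝ)) s = (-1) ^ s * ((s.factorial : ℝ) * (n.choose s : ℝ)) := by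
  rw [poch, ascPochhammer_eval_neg_eq_descPochhammer, descPochhammer_eval_eq_descFactorial,
    Nat.descFactorial_eq_factorial_mul_choose, Nat.cast_mul]

/-- The terminating binomial series `₁F₀(-n; t) = (1 - t) ^ n`. -/
theorem sum_poch_neg_nat (n : ℕ) (t : ℝ) :
    ∑ s ∈ range (n + 1), poch (-(n : ℝ)) s / (s.factorial : ℝ) * t ^ s = (1 - t) ^ n := by
  rw [sub_eq_neg_add, add_pow]
  refine sum_congr rfl fun s _ => ?_
  rw [poch_neg_nat, neg_pow t]
  field_simp
  simp

theorem integrableOn_exp_mul_rpow_mul_pow {c r : ℝ} (hc : 0 < c) (hr : -1 < r) (n : ℕ) :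
    IntegrableOn (fun x : ℝ => Real.exp (-(c * x)) * x ^ r * x ^ n) (Set.Ioi 0) := by
  have hn : (0 : ℝ) ≤ n := n.cast_nonneg
  have h := integrableOn_rpow_mul_exp_neg_mul_rpow (s := r + n) (p := 1) (b := c)
    (by linarith) one_pos hc
  refine h.congr_fun (fun x hx => ?_) measurableSet_Ioi
  have hx' : (0 : ℝ) < x := hx
  simp only [Real.rpow_one, Real.rpow_add_natCast hx'.ne', neg_mul]
  ring

theorem integral_exp_mul_rpow_mul_pow {c r : ℝ} (hc : 0 < c) (hr : -1 < r) (n : ℕ) :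
    ∫ x in Set.Ioi (0 : ℝ), Real.exp (-(c * x)) * x ^ r * x ^ n
      = Real.Gamma (n + r + 1) / (c ^ (r + 1) * c ^ n) := by
  have hn : (0 : ℝ) ≤ n := n.cast_nonneg
  have h := Real.integral_rpow_mul_exp_neg_mul_Ioi (a := n + r + 1) (r := c) (by linarith) hc
  rw [show (n : ℝ) + r + 1 - 1 = r + n by ring] at h
  rw [← Real.rpow_add_natCast hc.ne', show r + 1 + (n : ℝ) = n + r + 1 by ring, div_eq_inv_mul,
    ← Real.inv_rpow hc.le, ← one_div, ← h]
  refine setIntegral_congr_fun measurableSet_Ioi fun x hx => ?_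
  have hx' : (0 : ℝ) < x := hx
  simp only [Real.rpow_add_natCast hx'.ne']
  ring

theorem integral_integral_sum_sum {α β ι κ : Type*} [MeasurableSpace α] [MeasurableSpace β]
    {μ : Measure α} {ν : Measure β} (S : Finset ι) (T : ι → Finset κ) (C : ι → κ → ℝ)
    (f : ι → α → ℝ) (g : κ → β → ℝ) (hf : ∀ i, Integrable (f i) μ)
    (hg : ∀ j, Integrable (g j) ν) :
    ∫ y, ∫ z, ∑ i ∈ S, ∑ j ∈ T i, C i j * f i y * g j z ∂ν ∂μ
      = ∑ i ∈ S, ∑ j ∈ T i, C i j * (∫ y, f i y ∂μ) * ∫ z, g j z ∂ν := by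
  have hz (y : α) : ∫ z, ∑ i ∈ S, ∑ j ∈ T i, C i j * f i y * g j z ∂ν
      = ∑ i ∈ S, ∑ j ∈ T i, C i j * f i y * ∫ z, g j z ∂ν := by
    rw [integral_finsetSum _ fun i _ => integrable_finsetSum _ fun j _ => (hg j).const_mul _]
    refine sum_congr rfl fun i _ => ?_
    rw [integral_finsetSum _ fun j _ => (hg j).const_mul _]
    simp only [integral_const_mul]
  simp only [hz]
  have hy (i : ι) (j : κ) : Integrable (fun y => C i j * f i y * ∫ z, g j z ∂ν) μ :=
    ((hf i).const_mul _).mul_const _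
  rw [integral_finsetSum _ fun i _ => integrable_finsetSum _ fun j _ => hy i j]
  refine sum_congr rfl fun i _ => ?_
  rw [integral_finsetSum _ fun j _ => hy i j]
  simp only [integral_mul_const, integral_const_mul]

/-- Summing out the second index of the double series of the M-Konhauser polynomial. -/
theorem sum_sum_poch_eq_BesselY (k : ℕ) (p x t : ℝ) (ht : 1 - t ≠ 0) :
    ∑ l ∈ range (k + 1), ∑ s ∈ range (k - l + 1),
        poch (-(k : ℝ)) (l + s) * poch ((k : ℝ) + 1 - p) l * (-x) ^ l * t ^ s /
          ((l.factorial : ℝ) * (s.factorial : ℝ))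
      = (1 - t) ^ k * BesselY k (x / (1 - t)) (2 - p) 1 := by
  rw [BesselY, mul_sum]
  refine sum_congr rfl fun l hl => ?_
  have hlk : l ≤ k := Nat.lt_succ_iff.mp (mem_range.mp hl)
  have hcast : -(k : ℝ) + l = -((k - l : ℕ) : ℝ) := by
    rw [Nat.cast_sub hlk]
    ring
  calc
    _ = poch (-(k : ℝ)) l * poch ((k : ℝ) + 1 - p) l * (-x) ^ l / (l.factorial : ℝ) *
        ∑ s ∈ range (k - l + 1), poch (-((k - l : ℕ) : ℝ)) s / (s.factorial : ℝ) * t ^ s := by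
      rw [mul_sum]
      refine sum_congr rfl fun s _ => ?_
      rw [poch_add, hcast]
      ring
    _ = _ := by
      rw [sum_poch_neg_nat, div_one, ← neg_div, div_pow, ← Nat.sub_add_cancel hlk, pow_add,
        Nat.add_sub_cancel, Nat.sub_add_cancel hlk,
        show (k : ℝ) + (2 - p) - 1 = (k : ℝ) + 1 - p by ring]
      field_simp

/-- Double Laplace transform of the finite bivariate M-Konhauser polynomials,
expressed through generalized Bessel polynomials. -/
theorem MK_double_laplace_Bessel (υ : ℕ) (hυ : 0 < υ) (k : ℕ) (p q : ℝ) (hq : q > -1)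
    (hpq : p + q < 1) (a b w₁ w₂ : ℝ) (ha : 0 < a) (hb : 0 < b)
    (hw : w₂ ^ υ ≠ b ^ υ) :
    (∫ y in Set.Ioi (0 : ℝ), ∫ z in Set.Ioi (0 : ℝ),
        Real.exp (-(a * y + b * z)) * y ^ q * z ^ (-p - q) * MK p q υ k (w₁ * y) (w₂ * z))
      = Real.Gamma ((k : ℝ) + q + 1) / (a ^ (q + 1) * b ^ (1 - p - q)) *
          ((w₂ ^ υ - b ^ υ) / b ^ υ) ^ k *
          BesselY k (w₁ * b ^ υ / (a * (b ^ υ - w₂ ^ υ))) (2 - p) 1 := by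
  have hbυ : b ^ υ ≠ 0 := (pow_pos hb υ).ne'
  have hd : b ^ υ - w₂ ^ υ ≠ 0 := sub_ne_zero.mpr hw.symm
  have ht : 1 - w₂ ^ υ / b ^ υ = (b ^ υ - w₂ ^ υ) / b ^ υ := by
    rw [sub_div, div_self hbυ]
  have hx : w₁ * b ^ υ / (a * (b ^ υ - w₂ ^ υ)) = w₁ / a / (1 - w₂ ^ υ / b ^ υ) := by
    rw [ht]
    field_simp
  have hsign : ((w₂ ^ υ - b ^ υ) / b ^ υ) ^ k = (-1) ^ k * (1 - w₂ ^ υ / b ^ υ) ^ k := by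
    rw [ht, ← mul_pow]
    ring
  have hr : -1 < -p - q := by linarith
  let C (l s : ℕ) : ℝ := (-1) ^ k * Real.Gamma (k + q + 1) *
    (poch (-(k : ℝ)) (l + s) * poch ((k : ℝ) + 1 - p) l * (-w₁) ^ l * w₂ ^ (υ * s) /
      (Real.Gamma ((l : ℝ) + q + 1) * Real.Gamma ((υ : ℝ) * (s : ℝ) - p - q + 1) *
        (l.factorial : ℝ) * (s.factorial : ℝ)))
  have hexpand (y z : ℝ) :
      Real.exp (-(a * y + b * z)) * y ^ q * z ^ (-p - q) * MK p q υ k (w₁ * y) (w₂ * z)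
        = ∑ l ∈ range (k + 1), ∑ s ∈ range (k - l + 1), C l s *
          (Real.exp (-(a * y)) * y ^ q * y ^ l) *
          (Real.exp (-(b * z)) * z ^ (-p - q) * z ^ (υ * s)) := by
    simp only [MK, mul_sum, C]
    refine sum_congr rfl fun l _ => sum_congr rfl fun s _ => ?_
    rw [neg_add, Real.exp_add, ← neg_mul w₁ y, mul_pow, mul_pow]
    ring
  simp only [hexpand]
  rw [integral_integral_sum_sum _ _ C _ _
    (fun l => integrableOn_exp_mul_rpow_mul_pow ha hq l)
    (fun s => integrableOn_exp_mul_rpow_mul_pow hb hr (υ * s))]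
  simp only [integral_exp_mul_rpow_mul_pow ha hq, integral_exp_mul_rpow_mul_pow hb hr]
  have hB := sum_sum_poch_eq_BesselY k p (w₁ / a) (w₂ ^ υ / b ^ υ)
    (by rw [ht]; exact div_ne_zero hd hbυ)
  rw [hsign, hx, mul_assoc, mul_assoc, ← hB, mul_sum, mul_sum]
  refine sum_congr rfl fun l _ => ?_
  rw [mul_sum, mul_sum]
  refine sum_congr rfl fun s _ => ?_
  have hl : Real.Gamma ((l : ℝ) + q + 1) ≠ 0 :=
    (Real.Gamma_pos_of_pos (by linarith [l.cast_nonneg (α := ℝ)])).ne'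
  have hs : Real.Gamma ((υ : ℝ) * s - p - q + 1) ≠ 0 :=
    (Real.Gamma_pos_of_pos (by nlinarith [υ.cast_nonneg (α := ℝ), s.cast_nonneg (α := ℝ)])).ne'
  have haq : a ^ (q + 1) ≠ 0 := (Real.rpow_pos_of_pos ha _).ne'
  have hbq : b ^ (1 - p - q) ≠ 0 := (Real.rpow_pos_of_pos hb _).ne'
  have hlf : (l.factorial : ℝ) ≠ 0 := Nat.cast_ne_zero.mpr l.factorial_ne_zero
  have hsf : (s.factorial : ℝ) ≠ 0 := Nat.cast_ne_zero.mpr s.factorial_ne_zero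
  rw [Nat.cast_mul, show (υ : ℝ) * s + (-p - q) + 1 = (υ : ℝ) * s - p - q + 1 by ring,
    show -p - q + 1 = 1 - p - q by ring, ← neg_div, div_pow, div_pow, ← pow_mul, ← pow_mul]
  simp only [C]
  generalize Real.Gamma ((l : ℝ) + q + 1) = G₁ at *
  generalize Real.Gamma ((υ : ℝ) * s - p - q + 1) = G₂ at *
  generalize a ^ (q + 1) = A at *
  generalize b ^ (1 - p - q) = B at *
  field_simp
end
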